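/- Let m, n ∈ ℕ⁺ and let σ : ℝ → ℝ be continuous, non-affine, injective, without fixed points, and differentiable at at least one point with nonzero derivative at that point. Let f̂ : ℝ^m → ℝ^n be a function, let ε, δ > 0, let f ∈ C(ℝ^m,ℝ^n), and suppose there exists a continuous f̃₀ : ℝ^m → ℝ^n with d_ucc(f̂, f̃₀) < δ. Then there exist J, J₁ ∈ ℕ with 0 ≤ J₁ < J and affine maps W_j : ℝ^{d_j} → ℝ^{d_{j+1}} (j = 1,…,J) such that the deep feed-forward network f_{ε,δ} = W_J ∘ σ• ∘ ⋯ ∘ σ• ∘ W_1 satisfies: (i) d_ucc(f̂, W_J ∘ σ• ∘ ⋯ ∘ σ• ∘ W_{J₁}) < δ (with the convention that this composition is the identity precomposition when J₁ = 0); (ii) d_ucc(f, f_{ε,δ}) < ε; (iii) for each j = 1,…,J₁ the matrix of the linear part of W_j has at most m nonzero entries; (iv) d_j ≤ m + n + 2 for J₁ < j ≤ J, and d_j = m for 0 ≤ j ≤ J₁. -/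

import Mathlib

/-- Euclidean norm on `ℝ^n` (as functions `Fin n → ℝ`). -/
noncomputable def eNorm {n : ℕ} (y : Fin n → ℝ) : ℝ := Real.sqrt (∑ i, (y i) ^ 2)

/-- `s_k(f,g) = sup_{x ∈ [-k,k]^m} ‖f(x) - g(x)‖` (valued in `ℝ≥0∞`). -/
noncomputable def sK {m n : ℕ} (k : ℕ) (f g : (Fin m → ℝ) → (Fin n → ℝ)) : ENNReal :=
  ⨆ x ∈ {x : Fin m → ℝ | ∀ i, |x i| ≤ (k : ℝ)}, ENNReal.ofReal (eNorm (f x - g x))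

/-- The metric `d_ucc(f,g) = Σ_{k ≥ 1} 2^{-k} s_k/(1+s_k)` on (possibly discontinuous)
functions, with summand `1` when the sup is infinite; on continuous functions it induces
the topology of uniform convergence on compact sets. -/
noncomputable def ducc {m n : ℕ} (f g : (Fin m → ℝ) → (Fin n → ℝ)) : ℝ :=
  ∑' k : ℕ, (1 / 2 : ℝ) ^ (k + 1) *
    (if sK (k + 1) f g = ⊤ then 1
     else (sK (k + 1) f g).toReal / (1 + (sK (k + 1) f g).toReal))

/-- `headNet σ A c k = σ•(A_{k-1}· + c_{k-1}) ∘ ⋯ ∘ σ•(A₀· + c₀)`: a `k`-layer stack of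
width-`m` layers, each an affine map followed by the componentwise activation `σ`. -/
noncomputable def headNet (σ : ℝ → ℝ) {m : ℕ} (A : ℕ → Matrix (Fin m) (Fin m) ℝ)
    (c : ℕ → (Fin m → ℝ)) : ℕ → (Fin m → ℝ) → (Fin m → ℝ)
  | 0 => fun x => x
  | (k + 1) => fun x i => σ ((A k).mulVec (headNet σ A c k x) i + c k i)

/-- Deep feed-forward networks with activation `σ` all of whose layer dimensions are
bounded by `W`. -/
inductive IsNetworkW (σ : ℝ → ℝ) (W : ℕ) : ∀ {m n : ℕ}, ((Fin m → ℝ) → (Fin n → ℝ)) → Prop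
  | affine {m n : ℕ} (hm : m ≤ W) (hn : n ≤ W) (A : Matrix (Fin n) (Fin m) ℝ)
      (b : Fin n → ℝ) : IsNetworkW σ W (fun x => A.mulVec x + b)
  | comp {m k n : ℕ} (hm : m ≤ W) (hk : k ≤ W) (A : Matrix (Fin k) (Fin m) ℝ)
      (b : Fin k → ℝ) (g : (Fin k → ℝ) → (Fin n → ℝ)) (hg : IsNetworkW σ W g) :
      IsNetworkW σ W (fun x => g (fun i => σ (A.mulVec x i + b i)))

open Filter Topology Set
open fwdDiff

theorem setIntegral_mem_of_isClosed {E : Type*} [NormedAddCommGroup E] [NormedSpace ℝ E]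
    [CompleteSpace E] {S : Submodule ℝ E} (hS : IsClosed (S : Set E)) {u : ℝ → E}
    (hu : Continuous u) (hmem : ∀ t, u t ∈ S) (a b : ℝ) : ∫ t in Ioc a b, u t ∈ S := by
  by_cases h0 : MeasureTheory.volume (Ioc a b) = 0
  · rw [MeasureTheory.Measure.restrict_eq_zero.mpr h0, MeasureTheory.integral_zero_measure]
    exact S.zero_mem
  · have h := S.convex.set_average_mem hS h0 measure_Ioc_lt_top.ne
      (Eventually.of_forall hmem) (hu.integrableOn_Ioc)
    rw [MeasureTheory.setAverage_eq] at h
    have hne : MeasureTheory.volume.real (Ioc a b) ≠ 0 := by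
      rw [MeasureTheory.measureReal_def]
      exact (ENNReal.toReal_ne_zero).mpr ⟨h0, measure_Ioc_lt_top.ne⟩
    exact (S.smul_mem_iff (inv_ne_zero hne)).mp h

theorem intervalIntegral_mem_of_isClosed {E : Type*} [NormedAddCommGroup E] [NormedSpace ℝ E]
    [CompleteSpace E] {S : Submodule ℝ E} (hS : IsClosed (S : Set E)) {u : ℝ → E}
    (hu : Continuous u) (hmem : ∀ t, u t ∈ S) (a b : ℝ) : ∫ t in a..b, u t ∈ S :=
  S.sub_mem (setIntegral_mem_of_isClosed hS hu hmem a b)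
    (setIntegral_mem_of_isClosed hS hu hmem b a)

section CompactSpace

variable {X : Type*} [TopologicalSpace X] [CompactSpace X]

theorem ContinuousMap.intervalIntegral_apply {u : ℝ → C(X, ℝ)} (hu : Continuous u) (a b : ℝ)
    (x : X) : (∫ t in a..b, u t) x = ∫ t in a..b, u t x :=
  ((ContinuousMap.evalCLM ℝ x).intervalIntegral_comp_comm (hu.intervalIntegrable a b)).symm

/-- If a family `F` in a closed subspace of `C(X, ℝ)` is pointwise differentiable with a
continuous family of derivatives, the derivatives lie in the subspace too. -/
theorem pointwise_deriv_mem {S : Submodule ℝ C(X, ℝ)} (hS : IsClosed (S : Set C(X, ℝ)))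
    {F F' : ℝ → C(X, ℝ)} (hF' : Continuous F')
    (hderiv : ∀ t x, HasDerivAt (fun s => F s x) (F' t x) t) (hF : ∀ t, F t ∈ S) (t : ℝ) :
    F' t ∈ S := by
  have hint : ∀ s, F s = F 0 + ∫ v in (0 : ℝ)..s, F' v := by
    intro s
    ext x
    rw [ContinuousMap.add_apply, ContinuousMap.intervalIntegral_apply hF',
      intervalIntegral.integral_eq_sub_of_hasDerivAt (fun u _ => hderiv u x)]
    · ring
    · exact ((ContinuousMap.evalCLM ℝ x).continuous.comp hF').intervalIntegrable _ _
  have hd : HasDerivAt F (F' t) t := by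
    have h := (intervalIntegral.integral_hasDerivAt_right (hF'.intervalIntegrable 0 t)
      hF'.aestronglyMeasurable.stronglyMeasurableAtFilter hF'.continuousAt).const_add (F 0)
    exact h.congr_of_eventuallyEq (Eventually.of_forall hint)
  have hmem := range_deriv_subset_closure_span_image F dense_univ (mem_range_self t)
  rw [hd.deriv] at hmem
  refine (closure_minimal ?_ hS) hmem
  refine Submodule.span_le.mpr ?_
  rintro _ ⟨s, -, rfl⟩
  exact hF s

theorem HasDerivAt.fwdDiff_iter {g g' : ℝ → ℝ} (h : ℝ) (hg : ∀ x, HasDerivAt g (g' x) x) (k : ℕ) :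
    ∀ x, HasDerivAt ((Δ_[h])^[k] g) ((Δ_[h])^[k] g' x) x := by
  induction k generalizing g g' with
  | zero => exact hg
  | succ k ih =>
    refine ih fun x => ?_
    exact (HasDerivAt.comp_add_const x h (hg (x + h))).sub (hg x)

theorem Continuous.fwdDiff_iter {g : ℝ → ℝ} (h : ℝ) (hg : Continuous g) (k : ℕ) :
    Continuous ((Δ_[h])^[k] g) := by
  induction k generalizing g with
  | zero => exact hg
  | succ k ih => exact ih ((hg.comp (continuous_add_const h)).sub hg)

/-- If all `g (s ℓ + b)` lie in a closed subspace `S`, so do all `ℓ ^ k * (Δ_h^k g) (s ℓ + b)`. -/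
theorem pow_mul_fwdDiff_iter_mem {S : Submodule ℝ C(X, ℝ)} (hS : IsClosed (S : Set C(X, ℝ)))
    (ℓ : C(X, ℝ)) (h : ℝ) (k : ℕ) : ∀ g : ℝ → ℝ, Continuous g →
    (∀ (s b : ℝ) (F : C(X, ℝ)), (∀ x, F x = g (s * ℓ x + b)) → F ∈ S) →
    ∀ (s b : ℝ) (F : C(X, ℝ)), (∀ x, F x = ℓ x ^ k * (Δ_[h])^[k] g (s * ℓ x + b)) → F ∈ S := by
  induction k with
  | zero =>
    intro g _ hmem s b F hF
    exact hmem s b F (by simpa using hF)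
  | succ k ih =>
    intro g hg hmem s b F hF
    set G : ℝ → ℝ := fun y => ∫ t in (0 : ℝ)..h, g (y + t) with hG
    have hG' : ∀ y, HasDerivAt G (Δ_[h] g y) y := by
      intro y
      have hprim : ∀ z, HasDerivAt (fun u => ∫ t in (0 : ℝ)..u, g t) (g z) z := fun z =>
        intervalIntegral.integral_hasDerivAt_right (hg.intervalIntegrable _ _)
          hg.aestronglyMeasurable.stronglyMeasurableAtFilter hg.continuousAt
      have hsub := (HasDerivAt.comp_add_const y h (hprim (y + h))).sub (hprim y)
      refine hsub.congr_of_eventuallyEq (Eventually.of_forall fun z => ?_)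
      simp only [hG, Pi.sub_apply]
      rw [intervalIntegral.integral_comp_add_left (fun t => g t) z,
        intervalIntegral.integral_interval_sub_left (hg.intervalIntegrable _ _)
          (hg.intervalIntegrable _ _), add_zero]
    have hGc : Continuous G := continuous_iff_continuousAt.mpr fun y => (hG' y).continuousAt
    have hGmem : ∀ (s b : ℝ) (F : C(X, ℝ)), (∀ x, F x = G (s * ℓ x + b)) → F ∈ S := by
      intro s b F hF
      let Φ : C(ℝ, C(X, ℝ)) := ContinuousMap.curry
        ⟨fun p : ℝ × X => g (s * ℓ p.2 + b + p.1), by fun_prop⟩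
      have hΦ : F = ∫ t in (0 : ℝ)..h, Φ t := by
        ext x
        rw [ContinuousMap.intervalIntegral_apply Φ.continuous, hF]
        rfl
      rw [hΦ]
      refine intervalIntegral_mem_of_isClosed hS Φ.continuous (fun t => ?_) 0 h
      refine hmem s (b + t) _ fun x => ?_
      change g _ = g _
      rw [add_assoc]
    have hDk := HasDerivAt.fwdDiff_iter h hG' k
    have hc1 := hGc.fwdDiff_iter h k
    have hc2 : Continuous ((Δ_[h])^[k] (Δ_[h] g)) := hg.fwdDiff_iter h (k + 1)
    let P : C(ℝ, C(X, ℝ)) := ContinuousMap.curry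
      ⟨fun p : ℝ × X => ℓ p.2 ^ k * (Δ_[h])^[k] G (p.1 * ℓ p.2 + b), by fun_prop⟩
    let P' : C(ℝ, C(X, ℝ)) := ContinuousMap.curry
      ⟨fun p : ℝ × X => ℓ p.2 ^ (k + 1) * (Δ_[h])^[k] (Δ_[h] g) (p.1 * ℓ p.2 + b), by fun_prop⟩
    have hFP : F = P' s := by
      ext x
      rw [hF]
      rfl
    rw [hFP]
    refine pointwise_deriv_mem hS (F := P) P'.continuous (fun t x => ?_)
      (fun t => ih G hGc hGmem t b _ fun x => rfl) s
    change HasDerivAt (fun s => ℓ x ^ k * (Δ_[h])^[k] G (s * ℓ x + b))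
      (ℓ x ^ (k + 1) * (Δ_[h])^[k] (Δ_[h] g) (t * ℓ x + b)) t
    have hin : HasDerivAt (fun s => s * ℓ x + b) (ℓ x) t := by
      simpa using ((hasDerivAt_id t).mul_const (ℓ x)).add_const b
    have := ((hDk (t * ℓ x + b)).comp t hin).const_mul (ℓ x ^ k)
    exact this.congr_deriv (by ring)

/-- A continuous function `g` none of whose iterated differences vanish identically generates,
through `g (s ℓ + b)`, a closed subspace containing the exponential of `ℓ`. -/
theorem exp_mem_of_fwdDiff_iter_ne_zero {S : Submodule ℝ C(X, ℝ)}
    (hS : IsClosed (S : Set C(X, ℝ))) (ℓ : C(X, ℝ)) {g : ℝ → ℝ} (hg : Continuous g)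
    (hne : ∀ k, ∃ h b, (Δ_[h])^[k] g b ≠ 0)
    (hmem : ∀ (s b : ℝ) (F : C(X, ℝ)), (∀ x, F x = g (s * ℓ x + b)) → F ∈ S) :
    NormedSpace.exp ℓ ∈ S := by
  have hpow : ∀ k, ℓ ^ k ∈ S := by
    intro k
    obtain ⟨h, b, hb⟩ := hne k
    refine (S.smul_mem_iff hb).mp (pow_mul_fwdDiff_iter_mem hS ℓ h k g hg hmem 0 b _ fun x => ?_)
    simp [mul_comm]
  have hsum := NormedSpace.exp_series_hasSum_exp' (𝕂 := ℝ) ℓ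
  exact hS.mem_of_tendsto hsum (Eventually.of_forall fun s =>
    S.sum_mem fun i _ => S.smul_mem _ (hpow i))

end CompactSpace

/-- Density of shallow networks: sums of ridge functions `g (a ⬝ x + b)` are dense in `C(K, ℝ)`. -/
theorem closure_span_ridge_eq_top {m : ℕ} (K : Set (Fin m → ℝ)) [CompactSpace K] {g : ℝ → ℝ}
    (hg : Continuous g) (hne : ∀ k, ∃ h b, (Δ_[h])^[k] g b ≠ 0) :
    (Submodule.span ℝ {F : C(K, ℝ) | ∃ (a : Fin m → ℝ) (b : ℝ),
      ∀ x : K, F x = g (a ⬝ᵥ x.1 + b)}).topologicalClosure = ⊤ := by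
  set S := (Submodule.span ℝ {F : C(K, ℝ) | ∃ (a : Fin m → ℝ) (b : ℝ),
      ∀ x : K, F x = g (a ⬝ᵥ x.1 + b)}).topologicalClosure with hSdef
  have hS : IsClosed (S : Set C(K, ℝ)) := Submodule.isClosed_topologicalClosure _
  let ℓ : (Fin m → ℝ) → C(K, ℝ) := fun a => ⟨fun x => a ⬝ᵥ x.1,
    continuous_const.dotProduct continuous_subtype_val⟩
  have hexp : ∀ a, NormedSpace.exp (ℓ a) ∈ S := fun a => by
    refine exp_mem_of_fwdDiff_iter_ne_zero hS (ℓ a) hg hne fun s b F hF => ?_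
    refine Submodule.le_topologicalClosure _ (Submodule.subset_span ⟨s • a, b, fun x => ?_⟩)
    rw [hF, smul_dotProduct, smul_eq_mul]
    rfl
  let E : Submonoid C(K, ℝ) :=
    { carrier := range fun a => NormedSpace.exp (ℓ a)
      one_mem' := ⟨0, by
        have : ℓ 0 = 0 := by ext x; simp [ℓ]
        simp [this, NormedSpace.exp_zero]⟩
      mul_mem' := by
        rintro _ _ ⟨a, rfl⟩ ⟨b, rfl⟩
        refine ⟨a + b, ?_⟩
        have : ℓ (a + b) = ℓ a + ℓ b := by ext x; simp [ℓ, add_dotProduct]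
        simp only [this]
        exact NormedSpace.exp_add }
  have hexp_apply : ∀ a (x : K), NormedSpace.exp (ℓ a) x = Real.exp (a ⬝ᵥ x.1) := by
    intro a x
    have h1 := (NormedSpace.exp_series_hasSum_exp' (𝕂 := ℝ) (ℓ a)).mapL
      (ContinuousMap.evalCLM ℝ x)
    have h2 := NormedSpace.exp_series_hasSum_exp' (𝕂 := ℝ) (a ⬝ᵥ x.1)
    rw [Real.exp_eq_exp_ℝ]
    exact h1.unique h2
  let A := Algebra.adjoin ℝ (E : Set C(K, ℝ))
  have hAS : Subalgebra.toSubmodule A ≤ S := by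
    rw [Algebra.adjoin_eq_span, Submonoid.closure_eq, Submodule.span_le]
    rintro _ ⟨a, rfl⟩
    exact hexp a
  have hsep : A.SeparatesPoints := by
    intro x y hxy
    obtain ⟨i, hi⟩ : ∃ i, x.1 i ≠ y.1 i := by
      by_contra! hcon
      exact hxy (Subtype.ext (funext hcon))
    refine ⟨_, ⟨NormedSpace.exp (ℓ (Pi.single i 1)), Algebra.subset_adjoin ⟨_, rfl⟩, rfl⟩, ?_⟩
    change NormedSpace.exp (ℓ (Pi.single i 1)) x ≠ NormedSpace.exp (ℓ (Pi.single i 1)) y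
    rw [hexp_apply, hexp_apply]
    simpa using hi
  have htop := ContinuousMap.subalgebra_topologicalClosure_eq_top_of_separatesPoints A hsep
  rw [eq_top_iff]
  intro F _
  have hF : F ∈ A.topologicalClosure := htop ▸ Algebra.mem_top
  exact closure_minimal hAS hS hF

theorem strictMono_of_injective_of_ne {g : ℝ → ℝ} (hg : Continuous g)
    (hinj : Function.Injective g) (hfix : ∀ x, g x ≠ x) : StrictMono g := by
  rcases hg.strictMono_of_inj hinj with h | h
  · exact h
  · exfalso
    obtain ⟨x, hx⟩ : ∃ x, g x = x := by
      have hsub : Continuous fun x => g x - x := by fun_prop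
      rcases le_total 0 (g 0) with h0 | h0
      · obtain ⟨x, hx⟩ := mem_range_of_exists_le_of_exists_ge hsub (c := 0)
          ⟨g 0, by have := h.antitone h0; linarith⟩ ⟨0, by simpa using h0⟩
        exact ⟨x, by simpa [sub_eq_zero] using hx⟩
      · obtain ⟨x, hx⟩ := mem_range_of_exists_le_of_exists_ge hsub (c := 0)
          ⟨0, by simpa using h0⟩ ⟨g 0, by have := h.antitone h0; linarith⟩
        exact ⟨x, by simpa [sub_eq_zero] using hx⟩
    exact hfix x hx

theorem forall_lt_or_forall_lt_of_ne {g : ℝ → ℝ} (hg : Continuous g) (hfix : ∀ x, g x ≠ x) :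
    (∀ x, x < g x) ∨ ∀ x, g x < x := by
  by_contra! hcon
  obtain ⟨⟨a, ha⟩, b, hb⟩ := hcon
  obtain ⟨x, hx⟩ := mem_range_of_exists_le_of_exists_ge (f := fun x => g x - x) (c := 0)
    (by fun_prop) ⟨a, by linarith⟩ ⟨b, by linarith⟩
  exact hfix x (by simpa [sub_eq_zero] using hx)

/-- Linear growth of a function along all arithmetic progressions of step `h`. -/
def LinearGrowth (h : ℝ) (g : ℝ → ℝ) : Prop :=
  ∀ y, ∃ C : ℝ, ∀ᶠ n : ℕ in atTop, |g (y + n • h)| ≤ C * n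

theorem LinearGrowth.fwdDiff_iter {h : ℝ} {g : ℝ → ℝ} (hg : LinearGrowth h g) (k : ℕ) :
    LinearGrowth h ((Δ_[h])^[k] g) := by
  induction k generalizing g with
  | zero => exact hg
  | succ k ih =>
    refine ih fun y => ?_
    obtain ⟨C, hC⟩ := hg y
    obtain ⟨C', hC'⟩ := hg (y + h)
    refine ⟨C' + C, ?_⟩
    filter_upwards [hC, hC'] with n h1 h2
    rw [show y + h + n • h = y + n • h + h by ring] at h2
    calc |g (y + n • h + h) - g (y + n • h)| ≤ _ := abs_sub _ _
      _ ≤ C' * n + C * n := add_le_add h2 h1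
      _ = _ := by ring

theorem LinearGrowth.fwdDiff_two_eq_zero {h : ℝ} {g : ℝ → ℝ} (hg : LinearGrowth h g)
    (h3 : ∀ y, (Δ_[h])^[3] g y = 0) (y : ℝ) : (Δ_[h])^[2] g y = 0 := by
  have hzero : ∀ k, 3 ≤ k → (Δ_[h])^[k] g y = 0 := by
    intro k hk
    obtain ⟨j, rfl⟩ := Nat.exists_eq_add_of_le' hk
    rw [Function.iterate_add_apply, show (Δ_[h])^[3] g = fun _ => 0 from funext h3]
    clear hk
    induction j with
    | zero => rfl
    | succ j ih => simpa [Function.iterate_succ_apply] using ih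
  have hshift : ∀ n : ℕ, 1 ≤ n → g (y + (n + 1) • h) = g y + (n + 1) * Δ_[h] g y
      + (n + 1) * n / 2 * (Δ_[h])^[2] g y := by
    intro n hn
    rw [shift_eq_sum_fwdDiff_iter h g, ← Finset.sum_subset (s₁ := Finset.range 3)]
    · simp only [Finset.sum_range_succ, Finset.sum_range_zero, nsmul_eq_mul, Nat.choose_zero_right,
        Nat.choose_one_right, Nat.cast_choose_two]
      push_cast
      simp
    · intro i hi
      simp only [Finset.mem_range] at *
      omega
    · intro i _ hi
      rw [hzero i (by simpa using hi), smul_zero]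
  obtain ⟨C, hC⟩ := hg y
  set d := (Δ_[h])^[2] g y
  by_contra hd
  have hdpos : 0 < |d| := abs_pos.mpr hd
  set B := C + |g y| + |Δ_[h] g y| with hB
  obtain ⟨n, hn, h1⟩ := ((tendsto_natCast_atTop_atTop.eventually_gt_atTop (2 * B / |d|)).and
    ((tendsto_add_atTop_nat 2).eventually hC)).exists
  have hn' : 2 * B / |d| < ((n + 1 : ℕ) : ℝ) := hn.trans (by push_cast; linarith)
  rw [div_lt_iff₀ hdpos] at hn'
  rw [show n + 2 = n + 1 + 1 from rfl, hshift (n + 1) (by omega)] at h1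
  push_cast at h1 hn'
  have hN : (0 : ℝ) ≤ n := n.cast_nonneg
  have habs : ((n : ℝ) + 1 + 1) * (n + 1) / 2 * |d|
      ≤ C * (n + 1 + 1) + |g y| + (n + 1 + 1) * |Δ_[h] g y| := by
    have h2 := abs_add_le (g y + ((n : ℝ) + 1 + 1) * Δ_[h] g y
      + (n + 1 + 1) * (n + 1) / 2 * d) (-(g y + ((n : ℝ) + 1 + 1) * Δ_[h] g y))
    rw [add_neg_cancel_comm, abs_mul, abs_of_nonneg (by positivity), abs_neg] at h2
    have h3 := abs_add_le (g y) (((n : ℝ) + 1 + 1) * Δ_[h] g y)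
    rw [abs_mul, abs_of_nonneg (by positivity : (0 : ℝ) ≤ n + 1 + 1)] at h3
    linarith
  nlinarith [abs_nonneg (g y)]

theorem LinearGrowth.fwdDiff_two_eq_zero_of_iter {h : ℝ} {g : ℝ → ℝ} (hg : LinearGrowth h g)
    (k : ℕ) (hk : ∀ y, (Δ_[h])^[k] g y = 0) (y : ℝ) : (Δ_[h])^[2] g y = 0 := by
  have key : ∀ j, (∀ y, (Δ_[h])^[j + 2] g y = 0) → ∀ y, (Δ_[h])^[2] g y = 0 := by
    intro j
    induction j with
    | zero => exact fun H => H
    | succ j ih =>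
      intro H
      refine ih fun z => ?_
      rw [add_comm, Function.iterate_add_apply]
      refine (hg.fwdDiff_iter j).fwdDiff_two_eq_zero (fun w => ?_) z
      rw [← Function.iterate_add_apply, show 3 + j = j + 1 + 2 by omega]
      exact H w
  refine key k (fun z => ?_) y
  rw [add_comm, Function.iterate_add_apply, show (Δ_[h])^[k] g = fun _ => 0 from funext hk]
  simp

theorem affine_of_fwdDiff_two_eq_zero {g : ℝ → ℝ} (hg : Continuous g) {s : ℝ} (hs : s = 1 ∨ s = -1)
    (h2 : ∀ h, 0 < h → ∀ y, (Δ_[s * h])^[2] g y = 0) : ∃ a b : ℝ, g = fun x => a * x + b := by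
  have hpos : ∀ h, 0 < h → ∀ y, g (y + 2 * h) - 2 * g (y + h) + g y = 0 := by
    intro h hh y
    rcases hs with rfl | rfl
    · have := h2 h hh y
      simp only [one_mul, Function.iterate_succ_apply, Function.iterate_zero_apply, fwdDiff] at this
      rw [show y + h + h = y + 2 * h by ring] at this
      linarith
    · have := h2 h hh (y + 2 * h)
      simp only [Function.iterate_succ_apply, Function.iterate_zero_apply, fwdDiff] at this
      rw [show y + 2 * h + -1 * h = y + h by ring, show y + h + -1 * h = y by ring] at this
      linarith
  have hmid' : ∀ x y, x ≤ y → g x + g y = 2 * g ((x + y) / 2) := by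
    intro x y hxy
    rcases hxy.eq_or_lt with rfl | hlt
    · rw [add_self_div_two]; ring
    · have := hpos ((y - x) / 2) (by linarith) x
      rw [show x + 2 * ((y - x) / 2) = y by ring,
        show x + (y - x) / 2 = (x + y) / 2 by ring] at this
      linarith
  have hmid : ∀ x y, g x + g y = 2 * g ((x + y) / 2) := by
    intro x y
    rcases le_total x y with h | h
    · exact hmid' x y h
    · rw [add_comm, add_comm x y]; exact hmid' y x h
  let T : ℝ →+ ℝ :=
    { toFun := fun x => g x - g 0
      map_zero' := sub_self _
      map_add' := fun x y => by
        have h1 := hmid x y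
        have h2 := hmid (x + y) 0
        rw [add_zero] at h2
        linarith }
  let L := T.toRealLinearMap (show Continuous fun x => g x - g 0 by fun_prop)
  refine ⟨L 1, g 0, funext fun x => ?_⟩
  have h1 : L x = L 1 * x := by
    have := L.map_smul x 1
    rwa [smul_eq_mul, mul_one, smul_eq_mul, mul_comm] at this
  rw [← h1]
  change g x = g x - g 0 + g 0
  ring

/-- No iterated difference of a non-affine fixed-point-free increasing function vanishes
identically; in particular such a function is not a polynomial. -/
theorem exists_fwdDiff_iter_ne_zero {g : ℝ → ℝ} (hg : Continuous g) (hmono : Monotone g)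
    (hfix : ∀ x, g x ≠ x) (hna : ¬ ∃ a b : ℝ, g = fun x => a * x + b) (k : ℕ) :
    ∃ h b, (Δ_[h])^[k] g b ≠ 0 := by
  by_contra! hcon
  apply hna
  obtain ⟨s, hs, hgrow⟩ : ∃ s : ℝ, (s = 1 ∨ s = -1) ∧ ∀ t, 0 ≤ t → |g (s * t)| ≤ |g 0| + t := by
    rcases forall_lt_or_forall_lt_of_ne hg hfix with h | h
    · refine ⟨-1, Or.inr rfl, fun t ht => abs_le.mpr ?_⟩
      have h1 := h (-1 * t)
      have h2 : g (-1 * t) ≤ g 0 := hmono (by linarith)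
      constructor <;> linarith [le_abs_self (g 0), abs_nonneg (g 0)]
    · refine ⟨1, Or.inl rfl, fun t ht => abs_le.mpr ?_⟩
      have h1 := h (1 * t)
      have h2 : g 0 ≤ g (1 * t) := hmono (by linarith)
      constructor <;> linarith [neg_abs_le (g 0), abs_nonneg (g 0)]
  have hss : s * s = 1 := by rcases hs with rfl | rfl <;> norm_num
  refine affine_of_fwdDiff_two_eq_zero hg hs fun h hh => ?_
  refine LinearGrowth.fwdDiff_two_eq_zero_of_iter (fun y => ?_) k (hcon _)
  refine ⟨|g 0| + |y| + h, ?_⟩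
  filter_upwards [tendsto_natCast_atTop_atTop.eventually_ge_atTop (|y| / h),
    eventually_ge_atTop 1] with n hn hn1
  rw [div_le_iff₀ hh] at hn
  have hsy : |s * y| = |y| := by rcases hs with rfl | rfl <;> simp
  have hle := abs_le.mp hsy.le
  have hb := hgrow (s * y + n * h) (by linarith)
  rw [show s * (s * y + n * h) = s * s * y + n * (s * h) by ring, hss, one_mul] at hb
  rw [nsmul_eq_mul]
  have hn1' : (1 : ℝ) ≤ n := by exact_mod_cast hn1
  nlinarith [abs_nonneg (g 0), abs_nonneg y]

section Networks

variable {σ : ℝ → ℝ} {W : ℕ}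

theorem IsNetworkW.continuous (hσ : Continuous σ) {m n : ℕ} {f : (Fin m → ℝ) → (Fin n → ℝ)}
    (hf : IsNetworkW σ W f) : Continuous f := by
  induction hf with
  | affine hm hn A b => exact (continuous_const.matrix_mulVec continuous_id).add continuous_const
  | comp hm hk A b g hg ih =>
    refine ih.comp (continuous_pi fun i => hσ.comp ?_)
    exact ((continuous_apply i).comp (continuous_const.matrix_mulVec continuous_id)).add
      continuous_const

theorem IsNetworkW.comp_affine {m k n : ℕ} {f : (Fin k → ℝ) → (Fin n → ℝ)}
    (hf : IsNetworkW σ W f) (hm : m ≤ W) (B : Matrix (Fin k) (Fin m) ℝ) (c : Fin k → ℝ) :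
    IsNetworkW σ W fun x => f (B.mulVec x + c) := by
  cases hf with
  | affine _ hn A b =>
    have := IsNetworkW.affine (σ := σ) hm hn (A * B) (A.mulVec c + b)
    convert this using 2 with x
    change A.mulVec (B.mulVec x + c) + b = _
    rw [Matrix.mulVec_add, Matrix.mulVec_mulVec, add_assoc]
  | comp _ hk A b g hg =>
    have := IsNetworkW.comp hm hk (A * B) (A.mulVec c + b) g hg
    convert this using 4 with x i
    rw [Matrix.mulVec_add, Matrix.mulVec_mulVec, Pi.add_apply, Pi.add_apply, add_assoc]

/-- The continuous functions that are limits, uniformly on compact sets, of networks. -/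
def networkClosure (σ : ℝ → ℝ) (W m n : ℕ) : Set C(Fin m → ℝ, Fin n → ℝ) :=
  closure {G | IsNetworkW σ W G}

theorem comp_affine_mem_networkClosure {m k n : ℕ} {G : C(Fin k → ℝ, Fin n → ℝ)}
    (hG : G ∈ networkClosure σ W k n) (hm : m ≤ W) (B : Matrix (Fin k) (Fin m) ℝ)
    {H : C(Fin m → ℝ, Fin k → ℝ)} (hH : ∀ x, H x = B.mulVec x) :
    G.comp H ∈ networkClosure σ W m n := by
  refine map_mem_closure (f := fun G' => G'.comp H)
    (ContinuousMap.continuous_precomp H) hG fun f hf => ?_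
  have := IsNetworkW.comp_affine hf hm B 0
  simp only [add_zero, ← hH] at this
  exact this

/-- Precomposing with a step `v ↦ v + σ (α ⬝ v + b) c` keeps a function approximable by networks:
one extra neuron computes the increment while the others approximate the identity. -/
theorem comp_step_mem_networkClosure (hσ : Continuous σ) {x₀ d : ℝ} (hd : d ≠ 0)
    (hder : HasDerivAt σ d x₀) {p n : ℕ} (hp : p + 1 ≤ W) {G : C(Fin p → ℝ, Fin n → ℝ)}
    (hG : G ∈ networkClosure σ W p n) (α c : Fin p → ℝ) (b : ℝ) {H : C(Fin p → ℝ, Fin p → ℝ)}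
    (hH : ∀ v, H v = v + σ (α ⬝ᵥ v + b) • c) :
    G.comp H ∈ networkClosure σ W p n := by
  rw [networkClosure, ← closure_closure]
  refine map_mem_closure (f := fun G' => G'.comp H)
    (ContinuousMap.continuous_precomp H) hG fun f hf => ?_
  have hslope : Continuous (dslope σ x₀) := by
    rw [← continuousOn_univ, continuousOn_dslope univ_mem]
    exact ⟨hσ.continuousOn, hder.differentiableAt⟩
  let P : C(ℝ, C(Fin p → ℝ, Fin p → ℝ)) := ContinuousMap.curry
    ⟨fun q : ℝ × (Fin p → ℝ) => fun i =>
      q.2 i * dslope σ x₀ (x₀ + q.1 * q.2 i) / d + σ (α ⬝ᵥ q.2 + b) * c i, by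
      have : Continuous fun q : ℝ × (Fin p → ℝ) => α ⬝ᵥ q.2 :=
        continuous_const.dotProduct continuous_snd
      fun_prop⟩
  have hP0 : P 0 = H := by
    ext v i
    rw [hH]
    change v i * dslope σ x₀ (x₀ + 0 * v i) / d + σ (α ⬝ᵥ v + b) * c i
      = v i + σ (α ⬝ᵥ v + b) * c i
    rw [zero_mul, add_zero, dslope_same, hder.deriv, mul_div_cancel_right₀ _ hd]
  have hcont : Continuous fun t => f.comp (P t) :=
    (ContinuousMap.continuous_postcomp f).comp P.continuous
  have hlim : Tendsto (fun t => f.comp (P t)) (𝓝[≠] 0) (𝓝 (f.comp H)) := by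
    rw [← hP0]
    exact hcont.continuousAt.tendsto.mono_left nhdsWithin_le_nhds
  refine mem_closure_of_tendsto hlim ?_
  filter_upwards [self_mem_nhdsWithin] with t ht
  have ht' : t ≠ 0 := ht
  let B : Matrix (Fin p) (Fin (p + 1)) ℝ := fun i =>
    Fin.snoc (α := fun _ => ℝ) (Pi.single i (t * d)⁻¹) (c i)
  let A : Matrix (Fin (p + 1)) (Fin p) ℝ :=
    Fin.snoc (α := fun _ => Fin p → ℝ) (fun i => Pi.single i t) α
  have hnet := IsNetworkW.comp (σ := σ) (by omega) hp A
    (Fin.snoc (α := fun _ => ℝ) (fun _ => x₀) b) _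
    (IsNetworkW.comp_affine hf hp B (fun _ => -(σ x₀ * (t * d)⁻¹)))
  convert hnet using 1
  funext v
  change f _ = f _
  congr 1
  funext i
  change v i * dslope σ x₀ (x₀ + t * v i) / d + σ (α ⬝ᵥ v + b) * c i = _
  have hrow : ∀ z : Fin (p + 1) → ℝ,
      B.mulVec z i = (t * d)⁻¹ * z i.castSucc + c i * z (Fin.last p) := by
    intro z
    change ∑ j, B i j * z j = _
    rw [Fin.sum_univ_castSucc]
    simp [B, Pi.single_apply]
  have hA1 : A.mulVec v i.castSucc = t * v i := by
    change A i.castSucc ⬝ᵥ v = _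
    simp [A]
  have hA2 : A.mulVec v (Fin.last p) = α ⬝ᵥ v := by
    change A (Fin.last p) ⬝ᵥ v = _
    simp [A]
  rw [Pi.add_apply, hrow, hA1, hA2, Fin.snoc_castSucc, Fin.snoc_last, add_comm _ x₀]
  by_cases hv : v i = 0
  · rw [hv]
    simp [mul_comm]
  · rw [dslope_of_ne _ (by simp [ht', hv]), slope_def_field]
    field_simp
    ring

/-- Functions `s` that can be accumulated on output registers alongside input registers. -/
def Accumulable (σ : ℝ → ℝ) (W m n : ℕ) (s : (Fin m → ℝ) → (Fin n → ℝ)) : Prop :=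
  ∃ G ∈ networkClosure σ W (m + n) n, ∀ x y, G (Fin.append x y) = y + s x

theorem Accumulable.zero {m n : ℕ} (hW : m + n ≤ W) : Accumulable σ W m n fun _ => 0 := by
  let B : Matrix (Fin n) (Fin (m + n)) ℝ := fun i => Pi.single (Fin.natAdd m i) 1
  have hB : ∀ v i, B.mulVec v i = v (Fin.natAdd m i) := fun v i => by
    change B i ⬝ᵥ v = _
    simp [B]
  refine ⟨⟨fun v i => v (Fin.natAdd m i), by fun_prop⟩, subset_closure ?_, fun x y => ?_⟩
  · have := IsNetworkW.affine (σ := σ) hW (by omega) B 0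
    simp only [add_zero] at this
    have hfun : (fun v => B.mulVec v) = fun v i => v (Fin.natAdd m i) :=
      funext fun v => funext fun i => hB v i
    rw [hfun] at this
    exact this
  · ext i
    simp

theorem Accumulable.add_smul (hσ : Continuous σ) {x₀ d : ℝ} (hd : d ≠ 0)
    (hder : HasDerivAt σ d x₀) {m n : ℕ} (hW : m + n + 1 ≤ W) {s : (Fin m → ℝ) → (Fin n → ℝ)}
    (hs : Accumulable σ W m n s) (a : Fin m → ℝ) (b : ℝ) (c : Fin n → ℝ) :
    Accumulable σ W m n fun x => s x + σ (a ⬝ᵥ x + b) • c := by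
  obtain ⟨G, hG, hGs⟩ := hs
  have hdot : Continuous fun v : Fin (m + n) → ℝ => Fin.append a 0 ⬝ᵥ v :=
    continuous_const.dotProduct continuous_id
  refine ⟨_, comp_step_mem_networkClosure hσ hd hder hW hG (Fin.append a 0) (Fin.append 0 c) b
    (H := ⟨fun v => v + σ (Fin.append a 0 ⬝ᵥ v + b) • Fin.append 0 c, by fun_prop⟩)
    fun v => rfl, fun x y => ?_⟩
  have hdots : Fin.append a (0 : Fin n → ℝ) ⬝ᵥ Fin.append x y = a ⬝ᵥ x := by
    simp [dotProduct, Fin.sum_univ_add]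
  have hstate : Fin.append x y + σ (a ⬝ᵥ x + b) • Fin.append 0 c
      = Fin.append x (y + σ (a ⬝ᵥ x + b) • c) := by
    ext i
    refine Fin.addCases (fun i => ?_) (fun i => ?_) i <;> simp
  change G (Fin.append x y + σ (Fin.append a (0 : Fin n → ℝ) ⬝ᵥ Fin.append x y + b)
    • Fin.append 0 c) = _
  rw [hdots, hstate, hGs, add_assoc, add_comm (σ _ • c)]

theorem Accumulable.exists_mem_networkClosure {m n : ℕ} (hW : m + n ≤ W)
    {s : (Fin m → ℝ) → (Fin n → ℝ)} (hs : Accumulable σ W m n s) :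
    ∃ S ∈ networkClosure σ W m n, ∀ x, S x = s x := by
  obtain ⟨G, hG, hGs⟩ := hs
  let B : Matrix (Fin (m + n)) (Fin m) ℝ :=
    Fin.append (fun i => Pi.single i 1) 0
  have hB : ∀ x, Fin.append x (0 : Fin n → ℝ) = B.mulVec x := by
    intro x
    ext i
    change _ = B i ⬝ᵥ x
    refine Fin.addCases (fun i => ?_) (fun i => ?_) i <;> simp [B]
  refine ⟨_, comp_affine_mem_networkClosure (m := m) hG (by omega) B
    (H := ⟨fun x => B.mulVec x, continuous_const.matrix_mulVec continuous_id⟩) fun x => rfl,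
    fun x => ?_⟩
  change G (B.mulVec x) = _
  rw [← hB, hGs, zero_add]

theorem exists_network_near_of_mem_networkClosure {m n : ℕ} {S : C(Fin m → ℝ, Fin n → ℝ)}
    (hS : S ∈ networkClosure σ W m n) (K : Set (Fin m → ℝ)) [CompactSpace K] {ε : ℝ} (hε : 0 < ε) :
    ∃ f : (Fin m → ℝ) → (Fin n → ℝ), IsNetworkW σ W f ∧
      ∀ x ∈ K, dist (f x) (S x) < ε := by
  have hmem := map_mem_closure (f := fun G : C(Fin m → ℝ, Fin n → ℝ) => G.restrict K)
    (ContinuousMap.continuous_restrict K) hS (mapsTo_image _ _)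
  obtain ⟨_, ⟨f, hf, rfl⟩, hdist⟩ := Metric.mem_closure_iff.mp hmem ε hε
  refine ⟨f, hf, fun x hx => ?_⟩
  rw [dist_comm]
  exact (ContinuousMap.dist_apply_le_dist (f := S.restrict K) (g := f.restrict K)
    (⟨x, hx⟩ : K)).trans_lt hdist

/-- Universal approximation by networks of width `m + n + 1`. -/
theorem exists_network_near (hσ : Continuous σ) {x₀ d : ℝ} (hd : d ≠ 0)
    (hder : HasDerivAt σ d x₀) (hne : ∀ k, ∃ h b, (Δ_[h])^[k] σ b ≠ 0) {m n : ℕ}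
    (hW : m + n + 1 ≤ W) {f : (Fin m → ℝ) → (Fin n → ℝ)} (hf : Continuous f)
    {K : Set (Fin m → ℝ)} (hK : IsCompact K) {ε : ℝ} (hε : 0 < ε) :
    ∃ F : (Fin m → ℝ) → (Fin n → ℝ), IsNetworkW σ W F ∧ ∀ x ∈ K, dist (F x) (f x) < ε := by
  have : CompactSpace K := isCompact_iff_compactSpace.mp hK
  have hspan : ∀ s ∈ Submodule.span ℝ {F : C(K, ℝ) | ∃ (a : Fin m → ℝ) (b : ℝ),
      ∀ x : K, F x = σ (a ⬝ᵥ x.1 + b)}, ∃ s' : (Fin m → ℝ) → ℝ, (∀ x : K, s' x = s x) ∧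
      ∀ (c : Fin n → ℝ) (s₀ : (Fin m → ℝ) → (Fin n → ℝ)), Accumulable σ W m n s₀ →
        Accumulable σ W m n fun x => s₀ x + s' x • c := by
    intro s hs
    induction hs using Submodule.span_induction with
    | mem s hs =>
      obtain ⟨a, b, hab⟩ := hs
      exact ⟨fun x => σ (a ⬝ᵥ x + b), fun x => (hab x).symm,
        fun c s₀ h₀ => h₀.add_smul hσ hd hder hW a b c⟩
    | zero => exact ⟨fun _ => 0, fun x => rfl, fun c s₀ h₀ => by simpa using h₀⟩
    | add s t _ _ ihs iht =>
      obtain ⟨s', hs', hs⟩ := ihs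
      obtain ⟨t', ht', ht⟩ := iht
      refine ⟨fun x => s' x + t' x, fun x => by simp [hs', ht'], fun c s₀ h₀ => ?_⟩
      simpa only [add_smul, add_assoc] using ht c _ (hs c s₀ h₀)
    | smul r s _ ih =>
      obtain ⟨s', hs', hs⟩ := ih
      refine ⟨fun x => r * s' x, fun x => by simp [hs'], fun c s₀ h₀ => ?_⟩
      simpa only [smul_smul, mul_comm] using hs (r • c) s₀ h₀
  have hcoord : ∀ j : Fin n, ∃ s' : (Fin m → ℝ) → ℝ, (∀ x ∈ K, dist (s' x) (f x j) < ε / 2) ∧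
      ∀ (c : Fin n → ℝ) (s₀ : (Fin m → ℝ) → (Fin n → ℝ)), Accumulable σ W m n s₀ →
        Accumulable σ W m n fun x => s₀ x + s' x • c := by
    intro j
    let u : C(K, ℝ) := ⟨fun x => f x.1 j, by fun_prop⟩
    have hu : u ∈ closure ((Submodule.span ℝ {F : C(K, ℝ) | ∃ (a : Fin m → ℝ) (b : ℝ),
        ∀ x : K, F x = σ (a ⬝ᵥ x.1 + b)} : Submodule ℝ C(K, ℝ)) : Set C(K, ℝ)) := by
      rw [← Submodule.topologicalClosure_coe, closure_span_ridge_eq_top K hσ hne]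
      trivial
    obtain ⟨s, hs, hdist⟩ := Metric.mem_closure_iff.mp hu (ε / 2) (half_pos hε)
    obtain ⟨s', hs', hacc⟩ := hspan s hs
    refine ⟨s', fun x hx => ?_, hacc⟩
    rw [hs' ⟨x, hx⟩, dist_comm]
    exact (ContinuousMap.dist_apply_le_dist (f := u) (g := s) (⟨x, hx⟩ : K)).trans_lt hdist
  choose s' hs' hacc using hcoord
  have hsum : ∀ T : Finset (Fin n), Accumulable σ W m n
      fun x => ∑ j ∈ T, s' j x • (Pi.single j 1 : Fin n → ℝ) := by
    intro T
    induction T using Finset.induction_on with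
    | empty => simpa using Accumulable.zero (σ := σ) (by omega : m + n ≤ W)
    | insert j T hj ih =>
      simp_rw [Finset.sum_insert hj, add_comm (s' j _ • _)]
      exact hacc j _ _ ih
  obtain ⟨S, hS, hSx⟩ := (hsum Finset.univ).exists_mem_networkClosure (by omega)
  obtain ⟨F, hF, hFS⟩ := exists_network_near_of_mem_networkClosure hS K (half_pos hε)
  refine ⟨F, hF, fun x hx => ?_⟩
  have hSf : dist (S x) (f x) ≤ ε / 2 := by
    refine (dist_pi_le_iff (half_pos hε).le).mpr fun j => ?_
    rw [hSx, show (∑ i, s' i x • (Pi.single i 1 : Fin n → ℝ)) j = s' j x by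
      simp [Finset.sum_apply, Pi.single_apply]]
    exact (hs' j x hx).le
  linarith [dist_triangle (F x) (S x) (f x), hFS x hx]

end Networks

section Distance

variable {m n : ℕ}

theorem eNorm_eq_norm (y : Fin n → ℝ) : eNorm y = ‖WithLp.toLp 2 y‖ := by
  rw [EuclideanSpace.norm_eq]
  simp [eNorm]

theorem eNorm_add_le (y z : Fin n → ℝ) : eNorm (y + z) ≤ eNorm y + eNorm z := by
  simp only [eNorm_eq_norm, WithLp.toLp_add]
  exact norm_add_le _ _

theorem eNorm_le_mul_norm (y : Fin n → ℝ) : eNorm y ≤ n * ‖y‖ := by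
  refine Real.sqrt_le_iff.mpr ⟨by positivity, ?_⟩
  calc ∑ i, y i ^ 2 ≤ ∑ _i : Fin n, ‖y‖ ^ 2 := Finset.sum_le_sum fun i _ => by
        rw [← sq_abs]
        exact pow_le_pow_left₀ (abs_nonneg _) (norm_le_pi_norm y i) 2
    _ = n * ‖y‖ ^ 2 := by simp
    _ ≤ (n * ‖y‖) ^ 2 := by
        rw [mul_pow]
        gcongr
        exact_mod_cast Nat.le_self_pow two_ne_zero n

/-- The bounded transform `s ↦ s / (1 + s)` of `[0, ∞]` used in `ducc`. -/
noncomputable def boundedTransform (s : ENNReal) : ℝ :=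
  if s = ⊤ then 1 else s.toReal / (1 + s.toReal)

theorem boundedTransform_nonneg (s : ENNReal) : 0 ≤ boundedTransform s := by
  unfold boundedTransform
  split_ifs <;> positivity

theorem boundedTransform_le_one (s : ENNReal) : boundedTransform s ≤ 1 := by
  unfold boundedTransform
  split_ifs
  · exact le_rfl
  · rw [div_le_one (by positivity)]
    linarith

theorem boundedTransform_le_toReal {s : ENNReal} (hs : s ≠ ⊤) : boundedTransform s ≤ s.toReal := by
  unfold boundedTransform
  rw [if_neg hs]
  exact div_le_self ENNReal.toReal_nonneg (by linarith [ENNReal.toReal_nonneg (a := s)])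

theorem boundedTransform_le_add {r s t : ENNReal} (h : r ≤ s + t) :
    boundedTransform r ≤ boundedTransform s + boundedTransform t := by
  by_cases hs : s = ⊤
  · have h1 : boundedTransform s = 1 := by simp [boundedTransform, hs]
    linarith [boundedTransform_le_one r, boundedTransform_nonneg t]
  by_cases ht : t = ⊤
  · have h1 : boundedTransform t = 1 := by simp [boundedTransform, ht]
    linarith [boundedTransform_le_one r, boundedTransform_nonneg s]
  have hst : s + t ≠ ⊤ := ENNReal.add_ne_top.mpr ⟨hs, ht⟩
  have hr : r ≠ ⊤ := ne_top_of_le_ne_top hst h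
  have hle : r.toReal ≤ s.toReal + t.toReal := by
    rw [← ENNReal.toReal_add hs ht]
    exact ENNReal.toReal_mono hst h
  simp only [boundedTransform, if_neg hr, if_neg hs, if_neg ht]
  have hr0 := ENNReal.toReal_nonneg (a := r)
  have hs0 := ENNReal.toReal_nonneg (a := s)
  have ht0 := ENNReal.toReal_nonneg (a := t)
  generalize r.toReal = x at *
  generalize s.toReal = y at *
  generalize t.toReal = z at *
  calc x / (1 + x) ≤ (y + z) / (1 + (y + z)) := by
        rw [div_le_div_iff₀ (by positivity) (by positivity)]
        nlinarith
    _ = y / (1 + (y + z)) + z / (1 + (y + z)) := add_div _ _ _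
    _ ≤ y / (1 + y) + z / (1 + z) := by
        gcongr <;> linarith

theorem sK_triangle (k : ℕ) (f g h : (Fin m → ℝ) → (Fin n → ℝ)) :
    sK k f h ≤ sK k f g + sK k g h := by
  refine iSup₂_le fun x hx => ?_
  calc ENNReal.ofReal (eNorm (f x - h x))
      ≤ ENNReal.ofReal (eNorm (f x - g x) + eNorm (g x - h x)) := by
        refine ENNReal.ofReal_le_ofReal ?_
        simpa using eNorm_add_le (f x - g x) (g x - h x)
    _ ≤ ENNReal.ofReal (eNorm (f x - g x)) + ENNReal.ofReal (eNorm (g x - h x)) :=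
        ENNReal.ofReal_add_le
    _ ≤ _ := add_le_add
        (le_iSup₂ (f := fun x (_ : x ∈ {x : Fin m → ℝ | ∀ i, |x i| ≤ (k : ℝ)}) =>
          ENNReal.ofReal (eNorm (f x - g x))) x hx)
        (le_iSup₂ (f := fun x (_ : x ∈ {x : Fin m → ℝ | ∀ i, |x i| ≤ (k : ℝ)}) =>
          ENNReal.ofReal (eNorm (g x - h x))) x hx)

theorem summable_half_pow_succ : Summable fun k : ℕ => (1 / 2 : ℝ) ^ (k + 1) :=
  (summable_nat_add_iff 1).mpr summable_geometric_two

theorem tsum_half_pow_succ (N : ℕ) : ∑' k : ℕ, (1 / 2 : ℝ) ^ (k + N + 1) = (1 / 2) ^ N := by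
  have : ∀ k : ℕ, (1 / 2 : ℝ) ^ (k + N + 1) = (1 / 2) ^ k * (1 / 2) ^ (N + 1) := fun k => by
    rw [add_assoc, pow_add]
  simp_rw [this]
  rw [tsum_mul_right, tsum_geometric_two, pow_succ]
  ring

theorem summable_ducc (f g : (Fin m → ℝ) → (Fin n → ℝ)) :
    Summable fun k : ℕ => (1 / 2 : ℝ) ^ (k + 1) * boundedTransform (sK (k + 1) f g) :=
  summable_half_pow_succ.of_nonneg_of_le
    (fun _ => mul_nonneg (by positivity) (boundedTransform_nonneg _))
    fun _ => mul_le_of_le_one_right (by positivity) (boundedTransform_le_one _)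

theorem ducc_triangle (f g h : (Fin m → ℝ) → (Fin n → ℝ)) :
    ducc f h ≤ ducc f g + ducc g h := by
  change ∑' k : ℕ, (1 / 2 : ℝ) ^ (k + 1) * boundedTransform (sK (k + 1) f h)
    ≤ (∑' k : ℕ, (1 / 2 : ℝ) ^ (k + 1) * boundedTransform (sK (k + 1) f g))
      + ∑' k : ℕ, (1 / 2 : ℝ) ^ (k + 1) * boundedTransform (sK (k + 1) g h)
  rw [← (summable_ducc f g).tsum_add (summable_ducc g h)]
  refine (summable_ducc f h).tsum_le_tsum (fun k => ?_)
    ((summable_ducc f g).add (summable_ducc g h))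
  rw [← mul_add]
  exact mul_le_mul_of_nonneg_left (boundedTransform_le_add (sK_triangle _ _ _ _)) (by positivity)

/-- Closeness on the box `[-N, N]^m` controls `ducc` up to `2⁻ᴺ`. -/
theorem ducc_le_of_box {f g : (Fin m → ℝ) → (Fin n → ℝ)} {N : ℕ} {r : ℝ} (hr : 0 ≤ r)
    (h : ∀ x : Fin m → ℝ, (∀ i, |x i| ≤ N) → eNorm (f x - g x) ≤ r) :
    ducc f g ≤ r + (1 / 2) ^ N := by
  change ∑' k : ℕ, (1 / 2 : ℝ) ^ (k + 1) * boundedTransform (sK (k + 1) f g) ≤ _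
  rw [← (summable_ducc f g).sum_add_tsum_nat_add N]
  refine add_le_add ?_ ?_
  · calc ∑ k ∈ Finset.range N, (1 / 2 : ℝ) ^ (k + 1) * boundedTransform (sK (k + 1) f g)
        ≤ ∑ k ∈ Finset.range N, (1 / 2 : ℝ) ^ (k + 1) * r := by
          refine Finset.sum_le_sum fun k hk => mul_le_mul_of_nonneg_left ?_ (by positivity)
          have hle : sK (k + 1) f g ≤ ENNReal.ofReal r := by
            refine iSup₂_le fun x hx => ENNReal.ofReal_le_ofReal (h x fun i => (hx i).trans ?_)
            exact_mod_cast Finset.mem_range.mp hk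
          exact (boundedTransform_le_toReal (ne_top_of_le_ne_top ENNReal.ofReal_ne_top hle)).trans
            (ENNReal.toReal_le_of_le_ofReal hr hle)
      _ = (∑ k ∈ Finset.range N, (1 / 2 : ℝ) ^ (k + 1)) * r := (Finset.sum_mul _ _ _).symm
      _ ≤ 1 * r := by
          refine mul_le_mul_of_nonneg_right ?_ hr
          have := summable_half_pow_succ.sum_le_tsum (Finset.range N) fun _ _ => by positivity
          simpa using this.trans (tsum_half_pow_succ 0).le
      _ = r := one_mul r
  · rw [← tsum_half_pow_succ N]
    refine ((summable_nat_add_iff N).mpr (summable_ducc f g)).tsum_le_tsum (fun k => ?_)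
      ((summable_nat_add_iff N).mpr summable_half_pow_succ)
    exact mul_le_of_le_one_right (by positivity) (boundedTransform_le_one _)

end Distance

/-- A fixed-point-free continuous `σ` shifts a box off itself after a suitable translation of its
argument, so behaviours on the box and on its image can be prescribed independently. -/
theorem exists_shift_and_extension {m n : ℕ} (hm : 0 < m) {σ : ℝ → ℝ} (hσ : Continuous σ)
    (hinj : Function.Injective σ) (hfix : ∀ x, σ x ≠ x) {f g : (Fin m → ℝ) → (Fin n → ℝ)}
    (hf : Continuous f) (hg : Continuous g) (N : ℕ) :
    ∃ (C : ℝ) (G : C(Fin m → ℝ, Fin n → ℝ)), ∀ x : Fin m → ℝ, (∀ i, |x i| ≤ N) →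
      G x = g x ∧ G (fun i => σ (x i + C)) = f x := by
  obtain ⟨C, hC⟩ : ∃ C : ℝ, ∀ t : ℝ, |t| ≤ N → (N : ℝ) < |σ (t + C)| := by
    rcases forall_lt_or_forall_lt_of_ne hσ hfix with h | h
    · refine ⟨2 * N, fun t ht => lt_abs.mpr (Or.inl ?_)⟩
      linarith [h (t + 2 * N), (abs_le.mp ht).1]
    · refine ⟨-(2 * N), fun t ht => lt_abs.mpr (Or.inr ?_)⟩
      linarith [h (t + -(2 * N)), (abs_le.mp ht).2]
  let K : Set (Fin m → ℝ) := Icc (fun _ => -(N : ℝ)) fun _ => (N : ℝ)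
  have hKmem : ∀ x : Fin m → ℝ, x ∈ K ↔ ∀ i, |x i| ≤ N := fun x => by
    simp only [K, mem_Icc, Pi.le_def, abs_le, forall_and]
  have : CompactSpace K := isCompact_iff_compactSpace.mp isCompact_Icc
  let e : K ⊕ K → (Fin m → ℝ) := Sum.elim (fun x => x.1) fun x i => σ (x.1 i + C)
  have he : Continuous e := by
    refine continuous_sum_dom.mpr ⟨continuous_subtype_val, ?_⟩
    exact continuous_pi fun i =>
      hσ.comp (((continuous_apply i).comp continuous_subtype_val).add continuous_const)
  have hdisj : ∀ x y : K, x.1 ≠ fun i => σ (y.1 i + C) := by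
    intro x y hxy
    have h1 := (hKmem _).mp x.2 ⟨0, hm⟩
    have h2 := hC _ ((hKmem _).mp y.2 ⟨0, hm⟩)
    rw [hxy] at h1
    exact absurd h1 (not_le.mpr h2)
  have heinj : Function.Injective e := by
    refine Function.Injective.sumElim Subtype.val_injective (fun x y hxy => ?_) hdisj
    exact Subtype.ext (funext fun i => add_right_cancel (hinj (congrFun hxy i)))
  obtain ⟨G, hG⟩ := ContinuousMap.exists_extension' (he.isClosedEmbedding heinj)
    (⟨Sum.elim (fun x => g x.1) fun x => f x.1, continuous_sum_dom.mpr
      ⟨hg.comp continuous_subtype_val, hf.comp continuous_subtype_val⟩⟩ : C(K ⊕ K, Fin n → ℝ))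
  refine ⟨C, G, fun x hx => ⟨?_, ?_⟩⟩
  · exact congrFun hG (Sum.inl ⟨x, (hKmem x).mpr hx⟩)
  · exact congrFun hG (Sum.inr ⟨x, (hKmem x).mpr hx⟩)

/-- feed-forward networks with approximately prescribed output behaviour.
The approximating network `f_{ε,δ} = tail ∘ head` splits into a head of `J₁` sparsely
connected width-`m` layers (each weight matrix has at most `m` nonzero entries) and a
tail which is a feed-forward network of width at most `m + n + 2` that is `δ`-close to
the prescribed behaviour `f̂`, while the whole network is `ε`-close to `f`. -/
theorem stmt_13 {m n : ℕ} (hm : 0 < m) (hn : 0 < n)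
    (σ : ℝ → ℝ) (hσ : Continuous σ)
    (hnonaff : ¬ ∃ a b : ℝ, σ = fun x => a * x + b)
    (hinj : Function.Injective σ) (hfix : ∀ x : ℝ, σ x ≠ x)
    (hdiff : ∃ x₀ d : ℝ, d ≠ 0 ∧ HasDerivAt σ d x₀)
    (fhat : (Fin m → ℝ) → (Fin n → ℝ)) (ε δ : ℝ) (hε : 0 < ε) (hδ : 0 < δ)
    (f : (Fin m → ℝ) → (Fin n → ℝ)) (hf : Continuous f)
    (ftilde : (Fin m → ℝ) → (Fin n → ℝ)) (hft : Continuous ftilde)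
    (hclose : ducc fhat ftilde < δ) :
    ∃ (J₁ : ℕ) (Ah : ℕ → Matrix (Fin m) (Fin m) ℝ) (ch : ℕ → (Fin m → ℝ))
      (tail : (Fin m → ℝ) → (Fin n → ℝ)),
      IsNetworkW σ (m + n + 2) tail ∧
      (∀ j < J₁, {p : Fin m × Fin m | Ah j p.1 p.2 ≠ 0}.ncard ≤ m) ∧
      ducc fhat tail < δ ∧
      ducc f (fun x => tail (headNet σ Ah ch J₁ x)) < ε := by
  obtain ⟨x₀, d, hd, hder⟩ := hdiff
  have hne := exists_fwdDiff_iter_ne_zero hσ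
    (strictMono_of_injective_of_ne hσ hinj hfix).monotone hfix hnonaff
  obtain ⟨η, hη, hηε, hηδ⟩ : ∃ η > 0, 2 * η < ε ∧ 2 * η < δ - ducc fhat ftilde := by
    have hmin : 0 < min ε (δ - ducc fhat ftilde) := lt_min hε (sub_pos.mpr hclose)
    refine ⟨min ε (δ - ducc fhat ftilde) / 3, by positivity, ?_, ?_⟩
    · linarith [min_le_left ε (δ - ducc fhat ftilde)]
    · linarith [min_le_right ε (δ - ducc fhat ftilde)]
  obtain ⟨N, hN⟩ := exists_pow_lt_of_lt_one hη (by norm_num : (1 / 2 : ℝ) < 1)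
  obtain ⟨C, G, hG⟩ := exists_shift_and_extension hm hσ hinj hfix hf hft N
  let K : Set (Fin m → ℝ) := Icc (fun _ => -(N : ℝ)) fun _ => (N : ℝ)
  have hKmem : ∀ x : Fin m → ℝ, (∀ i, |x i| ≤ N) → x ∈ K := fun x hx =>
    ⟨fun i => (abs_le.mp (hx i)).1, fun i => (abs_le.mp (hx i)).2⟩
  let shift : (Fin m → ℝ) → (Fin m → ℝ) := fun x i => σ (x i + C)
  have hshift : Continuous shift := by fun_prop
  have hn0 : (0 : ℝ) < n := Nat.cast_pos.mpr hn
  obtain ⟨F, hF, hFG⟩ := exists_network_near (W := m + n + 2) hσ hd hder hne (by omega)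
    G.continuous ((isCompact_Icc : IsCompact K).union (isCompact_Icc.image hshift))
    (div_pos hη hn0)
  have hnorm : ∀ y z : Fin n → ℝ, dist z y < η / n → eNorm (y - z) ≤ η := by
    intro y z hyz
    rw [dist_comm, dist_eq_norm, lt_div_iff₀ hn0] at hyz
    linarith [eNorm_le_mul_norm (y - z)]
  have hhead : ∀ x, headNet σ (fun _ => (1 : Matrix (Fin m) (Fin m) ℝ)) (fun _ _ => C) 1 x
      = shift x := by
    intro x
    funext i
    simp [headNet, shift]
  refine ⟨1, fun _ => 1, fun _ _ => C, F, hF, fun j _ => ?_, ?_, ?_⟩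
  · have hsub : {p : Fin m × Fin m | (1 : Matrix (Fin m) (Fin m) ℝ) p.1 p.2 ≠ 0}
        ⊆ (fun i => (i, i)) '' univ := by
      rintro ⟨i, j⟩ hij
      by_contra hcon
      refine hij (Matrix.one_apply_ne fun h => hcon ?_)
      exact ⟨i, mem_univ i, Prod.ext rfl h⟩
    calc _ ≤ ((fun i : Fin m => (i, i)) '' univ).ncard := ncard_le_ncard hsub (toFinite _)
      _ ≤ (univ : Set (Fin m)).ncard := ncard_image_le (toFinite _)
      _ = m := by rw [ncard_univ, Nat.card_eq_fintype_card, Fintype.card_fin]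
  · have hbox : ducc ftilde F ≤ η + (1 / 2) ^ N := ducc_le_of_box hη.le fun x hx => by
      rw [← (hG x hx).1]
      exact hnorm _ _ (hFG x (Or.inl (hKmem x hx)))
    linarith [ducc_triangle fhat ftilde F]
  · have hbox : ducc f (fun x => F (headNet σ (fun _ => 1) (fun _ _ => C) 1 x))
        ≤ η + (1 / 2) ^ N := ducc_le_of_box hη.le fun x hx => by
      rw [hhead, ← (hG x hx).2]
      exact hnorm _ _ (hFG _ (Or.inr ⟨x, hKmem x hx, rfl⟩))
    linarith
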